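/- Let μ be a σ-finite measure on a measurable space X, let h : X → ℝ be nonnegative measurable and T : X → ℝ measurable. Let I ⊆ ℝ be an open interval such that for every z ∈ I the functions x ↦ h(x)·exp(z·T(x)) and x ↦ T(x)·h(x)·exp(z·T(x)) are μ-integrable, and assume that for each z₀ ∈ I there is a neighborhood of z₀ in I and a μ-integrable function g with |T(x)|·h(x)·exp(z·T(x)) ≤ g(x) for all z in that neighborhood and μ-a.e. x. Define the log-partition function A(z) = log(∫ h(x)·exp(z·T(x)) dμ(x)), assumed positive under the integral (∫ h·exp(z·T) dμ > 0 for z ∈ I), and the exponential-family density q_z(x) = h(x)·exp(z·T(x) - A(z)). Then A is differentiable on I and A'(z) = ∫ T(x)·q_z(x) dμ(x), i.e. the derivative of the log-partition function equals the mean of the sufficient statistic T under q_z; equivalently, for μ-a.e. x, ∂/∂z [log q_z(x)] = T(x) - ∫ T·q_z dμ. -/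

import Mathlib

open MeasureTheory Real Filter Topology

/-- For an exponential family `q_z(x) = h(x) exp(z T(x) - A(z))` with log-partition
function `A(z) = log ∫ h exp(z T) dμ`, under integrability and local domination
hypotheses on an open interval `I`, the log-partition function is differentiable on `I`
and its derivative is the mean of the sufficient statistic: `A'(z) = ∫ T q_z dμ`. -/
theorem logPartition_deriv_eq_mean_sufficient_statistic
    {X : Type*} [MeasurableSpace X] (μ : Measure X) [SigmaFinite μ]
    (h : X → ℝ) (hh : Measurable h) (hh0 : ∀ x, 0 ≤ h x)
    (T : X → ℝ) (hT : Measurable T)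
    (a b : ℝ) (I : Set ℝ) (hI : I = Set.Ioo a b)
    (hint : ∀ z ∈ I, Integrable (fun x => h x * Real.exp (z * T x)) μ)
    (hTint : ∀ z ∈ I, Integrable (fun x => T x * (h x * Real.exp (z * T x))) μ)
    (hdom : ∀ z₀ ∈ I, ∃ U ∈ nhdsWithin z₀ I, ∃ g : X → ℝ, Integrable g μ ∧
      ∀ z ∈ U, ∀ᵐ x ∂μ, |T x| * (h x * Real.exp (z * T x)) ≤ g x)
    (hpos : ∀ z ∈ I, 0 < ∫ x, h x * Real.exp (z * T x) ∂μ)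
    (A : ℝ → ℝ) (hA : ∀ z, A z = Real.log (∫ x, h x * Real.exp (z * T x) ∂μ))
    (qd : ℝ → X → ℝ) (hqd : ∀ z x, qd z x = h x * Real.exp (z * T x - A z)) :
    ∀ z ∈ I, HasDerivAt A (∫ x, T x * qd z x ∂μ) z := by
  intro z hz
  subst hI
  obtain ⟨hz1, hz2⟩ := hz
  have hz : z ∈ Set.Ioo a b := ⟨hz1, hz2⟩
  have hc : (a + z) / 2 ∈ Set.Ioo a b := ⟨by linarith, by linarith⟩
  have hd : (z + b) / 2 ∈ Set.Ioo a b := ⟨by linarith, by linarith⟩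
  set c := (a + z) / 2 with hcdef
  set d := (z + b) / 2 with hddef
  have hcz : c < z := by linarith
  have hzd : z < d := by linarith
  -- differentiate under the integral sign; the bound comes from the two endpoints
  have key := hasDerivAt_integral_of_dominated_loc_of_deriv_le (μ := μ) (s := Set.Ioo c d)
    (F := fun w x => h x * Real.exp (w * T x))
    (F' := fun w x => T x * (h x * Real.exp (w * T x)))
    (bound := fun x => ‖T x * (h x * Real.exp (c * T x))‖ + ‖T x * (h x * Real.exp (d * T x))‖)
    (x₀ := z) (Ioo_mem_nhds hcz hzd)
    (Eventually.of_forall fun w => by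
      have : Measurable fun x => h x * Real.exp (w * T x) := by fun_prop
      exact this.aestronglyMeasurable)
    (hint z hz) (hTint z hz).aestronglyMeasurable
    (Eventually.of_forall fun x w hw => by
      have hexp : Real.exp (w * T x) ≤ Real.exp (c * T x) + Real.exp (d * T x) := by
        rcases le_total 0 (T x) with hx | hx
        · have := Real.exp_le_exp.2 (mul_le_mul_of_nonneg_right hw.2.le hx)
          have := Real.exp_pos (c * T x)
          linarith
        · have := Real.exp_le_exp.2 (mul_le_mul_of_nonpos_right hw.1.le hx)
          have := Real.exp_pos (d * T x)
          linarith
      simp only [norm_mul, Real.norm_eq_abs, abs_of_nonneg (hh0 x), Real.abs_exp]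
      rw [← mul_add, ← mul_add]
      have := hh0 x
      gcongr)
    ((hTint c hc).norm.add (hTint d hd).norm)
    (Eventually.of_forall fun x w _ => by
      have h1 : HasDerivAt (fun w : ℝ => w * T x) (T x) w := by
        simpa using (hasDerivAt_id w).mul_const (T x)
      have h2 := (h1.exp).const_mul (h x)
      exact h2.congr_deriv (by ring))
  have hlog := key.2.log (hpos z hz).ne'
  have hAeq : A = fun w => Real.log (∫ x, h x * Real.exp (w * T x) ∂μ) := funext hA
  have hexpA : Real.exp (A z) = ∫ x, h x * Real.exp (z * T x) ∂μ := by
    rw [hA z, Real.exp_log (hpos z hz)]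
  have hval : ∫ x, T x * qd z x ∂μ
      = (∫ x, T x * (h x * Real.exp (z * T x)) ∂μ) / ∫ x, h x * Real.exp (z * T x) ∂μ := by
    rw [← hexpA, ← integral_div]
    congr 1
    ext x
    rw [hqd, Real.exp_sub]
    ring
  rw [hval, hAeq]
  exact hlog
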